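/- Mutual-information bound for entanglement-assisted codes. Let 2 ≤ d ≤ n, q ≥ 2, K ≥ 1, and let ψ be a pure quantum state on R ⊗ A_f ⊗ X_1 ⊗ … ⊗ X_n ⊗ B_in, where R has dimension K, each X_i has dimension q, the marginal of ψ on R is the maximally mixed state (1/K)·Id_K, and the marginal of ψ on R ⊗ B_in is the tensor product of its marginals on R and on B_in. Let {1,…,n} = I ∪ J be a partition with |I| = n−d+1, |J| = d−1, and suppose S(X_I B_in)_ψ = S(R)_ψ + S(A_f)_ψ + S(X_J)_ψ. Then 2·log K ≤ S(X_{{1,…,n}})_ψ + S(X_I)_ψ − S(X_J)_ψ ≤ 2·S(X_I)_ψ. -/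

import Mathlib

open scoped BigOperators ComplexOrder

/-- Von Neumann entropy of a matrix: `-∑ λ_j log λ_j` over the eigenvalues,
if the matrix is Hermitian (else junk value 0). Natural logarithm,
with the convention `0 * log 0 = 0` (automatic since `Real.log 0 = 0`). -/
noncomputable def vnEntropy {m : Type*} [Fintype m] [DecidableEq m]
    (ρ : Matrix m m ℂ) : ℝ :=
  if h : ρ.IsHermitian then
    -∑ j, h.eigenvalues j * Real.log (h.eigenvalues j)
  else 0

/-- Marginal (partial trace) of a state on the composite system
`⨂_{i : ι} X_i` (with `X_i = ℂ^{dim i}`), keeping the factors in `S`. -/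
noncomputable def marginal {ι : Type*} [Fintype ι] [DecidableEq ι]
    {dim : ι → ℕ}
    (ρ : Matrix ((i : ι) → Fin (dim i)) ((i : ι) → Fin (dim i)) ℂ)
    (S : Finset ι) :
    Matrix ((i : {j : ι // j ∈ S}) → Fin (dim i.1))
           ((i : {j : ι // j ∈ S}) → Fin (dim i.1)) ℂ :=
  fun x y =>
    ∑ z : (i : {j : ι // j ∉ S}) → Fin (dim i.1),
      ρ (fun i => if h : i ∈ S then x ⟨i, h⟩ else z ⟨i, h⟩)
        (fun i => if h : i ∈ S then y ⟨i, h⟩ else z ⟨i, h⟩)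

/-- Entropy of the marginal of `ρ` on the factors in `S`. -/
noncomputable def mEnt {ι : Type*} [Fintype ι] [DecidableEq ι]
    {dim : ι → ℕ}
    (ρ : Matrix ((i : ι) → Fin (dim i)) ((i : ι) → Fin (dim i)) ℂ)
    (S : Finset ι) : ℝ :=
  vnEntropy (marginal ρ S)


/-- Restriction of a composite index along a subset inclusion. -/
def restInd {ι : Type*} [DecidableEq ι] {dim : ι → ℕ} {S T : Finset ι} (h : S ⊆ T)
    (x : (i : {j : ι // j ∈ T}) → Fin (dim i.1)) :
    (i : {j : ι // j ∈ S}) → Fin (dim i.1) :=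
  fun i => x ⟨i.1, h i.2⟩

open Matrix in
theorem vnEntropy_eq_roots {m : Type*} [Fintype m] [DecidableEq m]
    (ρ : Matrix m m ℂ) (h : ρ.IsHermitian) :
    vnEntropy ρ = (ρ.charpoly.roots.map (fun z => Real.negMulLog z.re)).sum := by
  rw [h.roots_charpoly_eq_eigenvalues, vnEntropy, dif_pos h, Multiset.map_map,
    ← Finset.sum_neg_distrib]
  change _ = ∑ j, Real.negMulLog ((h.eigenvalues j : ℂ)).re
  simp [Real.negMulLog]

open Matrix in
theorem vnEntropy_of_diag {m : Type*} [Fintype m] [DecidableEq m]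
    (ρ U : Matrix m m ℂ) (l : m → ℝ) (hU : Uᴴ * U = 1)
    (h : ρ = U * diagonal (fun i => (l i : ℂ)) * Uᴴ) :
    vnEntropy ρ = ∑ i, Real.negMulLog (l i) := by
  have hh : ρ.IsHermitian := by
    rw [h]
    apply isHermitian_mul_mul_conjTranspose
    rw [Matrix.IsHermitian, diagonal_conjTranspose]
    congr 1
    ext i
    simp
  rw [vnEntropy_eq_roots ρ hh]
  have : ρ.charpoly = (diagonal (fun i => (l i : ℂ))).charpoly := by
    rw [h, Matrix.mul_assoc, Matrix.charpoly_mul_comm, Matrix.mul_assoc, hU, Matrix.mul_one]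
  rw [this, Matrix.charpoly_diagonal, show (∏ i, (Polynomial.X - Polynomial.C (l i : ℂ))) =
      (((Finset.univ.val.map (fun i => (l i : ℂ))).map
        (fun a => Polynomial.X - Polynomial.C a)).prod) by rw [Multiset.map_map]; rfl,
    Polynomial.roots_multiset_prod_X_sub_C, Multiset.map_map]
  rfl

open Matrix in
theorem exists_diag {m : Type*} [Fintype m] [DecidableEq m]
    (ρ : Matrix m m ℂ) (h : ρ.PosSemidef) :
    ∃ (U : Matrix m m ℂ) (l : m → ℝ), Uᴴ * U = 1 ∧ U * Uᴴ = 1 ∧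
      ρ = U * diagonal (fun i => (l i : ℂ)) * Uᴴ ∧ (∀ i, 0 ≤ l i) ∧
      vnEntropy ρ = ∑ i, Real.negMulLog (l i) := by
  have h1 : (h.1.eigenvectorUnitary : Matrix m m ℂ)ᴴ * h.1.eigenvectorUnitary = 1 :=
    (Matrix.mem_unitaryGroup_iff' (A := (h.1.eigenvectorUnitary : Matrix m m ℂ))).1 h.1.eigenvectorUnitary.2
  have h2 : (h.1.eigenvectorUnitary : Matrix m m ℂ) * (h.1.eigenvectorUnitary : Matrix m m ℂ)ᴴ = 1 :=
    (Matrix.mem_unitaryGroup_iff (A := (h.1.eigenvectorUnitary : Matrix m m ℂ))).1 h.1.eigenvectorUnitary.2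
  have h3 : ρ = (h.1.eigenvectorUnitary : Matrix m m ℂ) *
      diagonal (fun i => (h.1.eigenvalues i : ℂ)) * (h.1.eigenvectorUnitary : Matrix m m ℂ)ᴴ := by
    conv_lhs => rw [h.1.spectral_theorem]
    rw [Unitary.conjStarAlgAut_apply]
    rfl
  exact ⟨_, _, h1, h2, h3, h.eigenvalues_nonneg, vnEntropy_of_diag _ _ _ h1 h3⟩

open Matrix in
/-- Entropy is bounded by the Shannon entropy of the diagonal in any orthonormal basis. -/
theorem vnEntropy_le_diag {m : Type*} [Fintype m] [DecidableEq m]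
    (ρ U : Matrix m m ℂ) (h : ρ.PosSemidef) (hU : Uᴴ * U = 1) (hU' : U * Uᴴ = 1) :
    vnEntropy ρ ≤ ∑ k, Real.negMulLog ((Uᴴ * ρ * U) k k).re := by
  obtain ⟨V, l, hV, hV', hρ, hl, hent⟩ := exists_diag ρ h
  set W := Uᴴ * V with hW
  have hW1 : W * Wᴴ = 1 := by
    rw [hW, conjTranspose_mul, conjTranspose_conjTranspose, Matrix.mul_assoc,
      ← Matrix.mul_assoc V, hV', Matrix.one_mul, hU]
  have hW2 : Wᴴ * W = 1 := by
    rw [hW, conjTranspose_mul, conjTranspose_conjTranspose, Matrix.mul_assoc,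
      ← Matrix.mul_assoc U, hU', Matrix.one_mul, hV]
  have hrow : ∀ k, ∑ j, Complex.normSq (W k j) = 1 := by
    intro k
    have := congrFun (congrFun hW1 k) k
    rw [Matrix.mul_apply, Matrix.one_apply_eq] at this
    simp only [conjTranspose_apply, Complex.star_def, Complex.mul_conj] at this
    exact_mod_cast this
  have hcol : ∀ j, ∑ k, Complex.normSq (W k j) = 1 := by
    intro k
    have := congrFun (congrFun hW2 k) k
    rw [Matrix.mul_apply, Matrix.one_apply_eq] at this
    simp only [conjTranspose_apply, Complex.star_def, mul_comm _ (W _ _), Complex.mul_conj] at this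
    exact_mod_cast this
  have hdiag : ∀ k, ((Uᴴ * ρ * U) k k).re = ∑ j, Complex.normSq (W k j) * l j := by
    intro k
    have e : Uᴴ * ρ * U = W * diagonal (fun i => (l i : ℂ)) * Wᴴ := by
      rw [hρ, hW, conjTranspose_mul, conjTranspose_conjTranspose]
      simp only [Matrix.mul_assoc]
    rw [e, Matrix.mul_apply, Complex.re_sum]
    refine Finset.sum_congr rfl fun j _ => ?_
    rw [Matrix.mul_diagonal, conjTranspose_apply, mul_right_comm, Complex.star_def,
      Complex.mul_conj, ← Complex.ofReal_mul, Complex.ofReal_re]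
  rw [hent]
  calc ∑ i, Real.negMulLog (l i)
      = ∑ j, ∑ k, Complex.normSq (W k j) * Real.negMulLog (l j) := by
        refine Finset.sum_congr rfl fun j _ => ?_
        rw [← Finset.sum_mul, hcol, one_mul]
    _ = ∑ k, ∑ j, Complex.normSq (W k j) * Real.negMulLog (l j) := Finset.sum_comm
    _ ≤ _ := by
        refine Finset.sum_le_sum fun k _ => ?_
        rw [hdiag]
        exact Real.concaveOn_negMulLog.le_map_sum (t := Finset.univ)
          (w := fun j => Complex.normSq (W k j)) (p := l)
          (fun j _ => Complex.normSq_nonneg _) (hrow k) (fun j _ => hl j)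

/-- Classical subadditivity. -/
theorem shannon_subadd {α β : Type*} [Fintype α] [Fintype β]
    (P : α → β → ℝ) (p : α → ℝ) (r : β → ℝ) (hP : ∀ i j, 0 ≤ P i j)
    (hp : ∀ i, ∑ j, P i j = p i) (hr : ∀ j, ∑ i, P i j = r j) (h1 : ∑ i, p i = 1) :
    ∑ i, ∑ j, Real.negMulLog (P i j) ≤ ∑ i, Real.negMulLog (p i) + ∑ j, Real.negMulLog (r j) := by
  have hr1 : ∑ j, r j = 1 := by
    rw [← h1]; simp_rw [← hp, ← hr]; exact Finset.sum_comm
  have hPp : ∀ i j, P i j ≤ p i := fun i j => by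
    rw [← hp]; exact Finset.single_le_sum (f := fun j => P i j) (fun j _ => hP i j) (Finset.mem_univ j)
  have hPr : ∀ i j, P i j ≤ r j := fun i j => by
    rw [← hr]; exact Finset.single_le_sum (f := fun i => P i j) (fun i _ => hP i j) (Finset.mem_univ i)
  have key : ∀ i j, Real.negMulLog (P i j) ≤
      - P i j * Real.log (p i) + - P i j * Real.log (r j) + p i * r j - P i j := by
    intro i j
    rcases (hP i j).eq_or_lt with h0 | h0
    · rw [← h0]
      have := mul_nonneg ((hP i j).trans (hPp i j)) ((hP i j).trans (hPr i j))
      simpa using this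
    · have a := h0.trans_le (hPp i j)
      have b := h0.trans_le (hPr i j)
      have := Real.log_le_sub_one_of_pos (div_pos (mul_pos a b) h0)
      rw [Real.log_div (mul_pos a b).ne' h0.ne', Real.log_mul a.ne' b.ne'] at this
      have h2 := mul_le_mul_of_nonneg_left this h0.le
      have h3 : P i j * (p i * r j / P i j - 1) = p i * r j - P i j := by field_simp
      rw [h3] at h2
      rw [Real.negMulLog]
      linarith
  calc _ ≤ ∑ i, ∑ j, (- P i j * Real.log (p i) + - P i j * Real.log (r j) + p i * r j - P i j) :=
        Finset.sum_le_sum fun i _ => Finset.sum_le_sum fun j _ => key i j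
    _ = _ := by
      simp only [Finset.sum_sub_distrib, Finset.sum_add_distrib]
      rw [Finset.sum_comm (f := fun i j => - P i j * Real.log (r j))]
      simp only [← Finset.sum_mul, ← Finset.mul_sum, hp, hr, hr1, h1, Finset.sum_neg_distrib,
        Real.negMulLog]
      ring

open Matrix in
theorem trace_of_diag {m : Type*} [Fintype m] [DecidableEq m]
    (ρ U : Matrix m m ℂ) (l : m → ℝ) (hU : Uᴴ * U = 1)
    (h : ρ = U * diagonal (fun i => (l i : ℂ)) * Uᴴ) (ht : ρ.trace = 1) : ∑ i, l i = 1 := by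
  rw [h, Matrix.mul_assoc, Matrix.trace_mul_comm, Matrix.mul_assoc, hU, Matrix.mul_one,
    Matrix.trace_diagonal] at ht
  exact_mod_cast ht

open Matrix in
theorem diag_of_diag {m : Type*} [Fintype m] [DecidableEq m]
    (ρ U : Matrix m m ℂ) (l : m → ℝ) (hU : Uᴴ * U = 1)
    (h : ρ = U * diagonal (fun i => (l i : ℂ)) * Uᴴ) (i : m) :
    (Uᴴ * ρ * U) i i = l i := by
  have : Uᴴ * ρ * U = (Uᴴ * U) * diagonal (fun i => (l i : ℂ)) * (Uᴴ * U) := by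
    rw [h]; simp only [Matrix.mul_assoc]
  rw [this, hU]; simp

open Matrix Kronecker in
/-- Quantum subadditivity on a product. -/
theorem vnEntropy_subadd {α β : Type*} [Fintype α] [DecidableEq α] [Fintype β] [DecidableEq β]
    (ρ : Matrix (α × β) (α × β) ℂ) (h : ρ.PosSemidef)
    (ρA : Matrix α α ℂ) (ρB : Matrix β β ℂ) (hA : ρA.PosSemidef) (hB : ρB.PosSemidef)
    (hAt : ρA.trace = 1)
    (eA : ∀ x y, ρA x y = ∑ z, ρ (x, z) (y, z)) (eB : ∀ x y, ρB x y = ∑ z, ρ (z, x) (z, y)) :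
    vnEntropy ρ ≤ vnEntropy ρA + vnEntropy ρB := by
  obtain ⟨V, p, hV, hV', hρA, hp, hpe⟩ := exists_diag ρA hA
  obtain ⟨W, r, hW, hW', hρB, hr, hre⟩ := exists_diag ρB hB
  have hU : (V ⊗ₖ W)ᴴ * (V ⊗ₖ W) = 1 := by
    rw [conjTranspose_kronecker, ← mul_kronecker_mul, hV, hW, one_kronecker_one]
  have hU' : (V ⊗ₖ W) * (V ⊗ₖ W)ᴴ = 1 := by
    rw [conjTranspose_kronecker, ← mul_kronecker_mul, hV', hW', one_kronecker_one]
  have hVe : ∀ a a', ∑ i, star (V a i) * V a' i = if a = a' then 1 else 0 := by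
    intro a a'
    have := congrFun (congrFun hV' a') a
    rw [Matrix.mul_apply, Matrix.one_apply] at this
    simp only [conjTranspose_apply] at this
    simp only [mul_comm, eq_comm] at this ⊢
    exact this
  have hWe : ∀ a a', ∑ i, star (W a i) * W a' i = if a = a' then 1 else 0 := by
    intro a a'
    have := congrFun (congrFun hW' a') a
    rw [Matrix.mul_apply, Matrix.one_apply] at this
    simp only [conjTranspose_apply] at this
    simp only [mul_comm, eq_comm] at this ⊢
    exact this
  have hentry : ∀ i j, ((V ⊗ₖ W)ᴴ * ρ * (V ⊗ₖ W)) (i, j) (i, j) =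
      ∑ a', ∑ b', ∑ a, ∑ b, (star (V a i) * ρ (a, b) (a', b') * V a' i) *
        (star (W b j) * W b' j) := by
    intro i j
    simp only [Matrix.mul_apply, Fintype.sum_prod_type, conjTranspose_apply, kroneckerMap_apply,
      Finset.sum_mul, star_mul']
    refine Finset.sum_congr rfl fun _ _ => Finset.sum_congr rfl fun _ _ =>
      Finset.sum_congr rfl fun _ _ => Finset.sum_congr rfl fun _ _ => ?_
    ring
  have hentry2 : ∀ i j, ((V ⊗ₖ W)ᴴ * ρ * (V ⊗ₖ W)) (i, j) (i, j) =
      ∑ b', ∑ a', ∑ b, ∑ a, (star (W b j) * ρ (a, b) (a', b') * W b' j) *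
        (star (V a i) * V a' i) := by
    intro i j
    rw [hentry, Finset.sum_comm]
    refine Finset.sum_congr rfl fun _ _ => Finset.sum_congr rfl fun _ _ => ?_
    rw [Finset.sum_comm]
    refine Finset.sum_congr rfl fun _ _ => Finset.sum_congr rfl fun _ _ => ?_
    ring
  have hsA : ∀ i, ∑ j, ((V ⊗ₖ W)ᴴ * ρ * (V ⊗ₖ W)) (i, j) (i, j) = p i := by
    intro i
    rw [← diag_of_diag ρA V p hV hρA i]
    simp only [hentry]
    rw [Finset.sum_comm]
    simp only [Matrix.mul_apply, conjTranspose_apply, eA, Finset.sum_mul, Finset.mul_sum]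
    refine Finset.sum_congr rfl fun a' _ => ?_
    refine Eq.trans ?_ Finset.sum_comm
    rw [Finset.sum_comm]
    refine Finset.sum_congr rfl fun b' _ => ?_
    rw [Finset.sum_comm]
    refine Finset.sum_congr rfl fun a _ => ?_
    rw [Finset.sum_comm]
    simp only [← Finset.mul_sum, hWe]
    simp
  have hsB : ∀ j, ∑ i, ((V ⊗ₖ W)ᴴ * ρ * (V ⊗ₖ W)) (i, j) (i, j) = r j := by
    intro j
    rw [← diag_of_diag ρB W r hW hρB j]
    simp only [hentry2]
    rw [Finset.sum_comm]
    simp only [Matrix.mul_apply, conjTranspose_apply, eB, Finset.sum_mul, Finset.mul_sum]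
    refine Finset.sum_congr rfl fun a' _ => ?_
    refine Eq.trans ?_ Finset.sum_comm
    rw [Finset.sum_comm]
    refine Finset.sum_congr rfl fun b' _ => ?_
    rw [Finset.sum_comm]
    refine Finset.sum_congr rfl fun a _ => ?_
    rw [Finset.sum_comm]
    simp only [← Finset.mul_sum, hVe]
    simp
  have hPSD : ((V ⊗ₖ W)ᴴ * ρ * (V ⊗ₖ W)).PosSemidef := h.conjTranspose_mul_mul_same _
  refine (vnEntropy_le_diag ρ (V ⊗ₖ W) h hU hU').trans ?_
  rw [hpe, hre, Fintype.sum_prod_type]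
  refine shannon_subadd (fun i j => (((V ⊗ₖ W)ᴴ * ρ * (V ⊗ₖ W)) (i, j) (i, j)).re) p r ?_ ?_ ?_ ?_
  · intro i j
    exact (Complex.le_def.1 (hPSD.diag_nonneg (i := (i, j)))).1
  · intro i
    have := congrArg Complex.re (hsA i)
    simpa using this
  · intro i
    have := congrArg Complex.re (hsB i)
    simpa using this
  · exact trace_of_diag ρA V p hV hρA hAt

open Matrix in
theorem vnEntropy_reindex {m k : Type*} [Fintype m] [DecidableEq m] [Fintype k] [DecidableEq k]
    (e : k ≃ m) (ρ : Matrix m m ℂ) (h : ρ.IsHermitian) :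
    vnEntropy (ρ.submatrix e e) = vnEntropy ρ := by
  rw [vnEntropy_eq_roots _ (h.submatrix e), vnEntropy_eq_roots _ h]
  have := Matrix.charpoly_reindex e.symm ρ
  rw [Matrix.reindex_apply, Equiv.symm_symm] at this
  rw [this]

open Matrix in
theorem vnEntropy_mul_comm {m k : Type*} [Fintype m] [DecidableEq m] [Fintype k] [DecidableEq k]
    (M : Matrix m k ℂ) :
    vnEntropy (M * Mᴴ) = vnEntropy (Mᴴ * M)ᵀ := by
  have h1 := (posSemidef_self_mul_conjTranspose M).1
  have h2 := (posSemidef_conjTranspose_mul_self M).1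
  rw [vnEntropy_eq_roots _ h1, vnEntropy_eq_roots _ h2.transpose, Matrix.charpoly_transpose]
  have := congrArg (fun P => (P.roots.map (fun z : ℂ => Real.negMulLog z.re)).sum)
    (Matrix.charpoly_mul_comm' M Mᴴ)
  rw [Polynomial.roots_mul, Polynomial.roots_mul] at this
  · simpa [Multiset.map_nsmul, Multiset.sum_nsmul] using this
  · exact mul_ne_zero (pow_ne_zero _ Polynomial.X_ne_zero) (Matrix.charpoly_monic _).ne_zero
  · exact mul_ne_zero (pow_ne_zero _ Polynomial.X_ne_zero) (Matrix.charpoly_monic _).ne_zero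

open Matrix in
theorem pure_vec {m : Type*} [Fintype m] [DecidableEq m]
    (ρ : Matrix m m ℂ) (h : ρ.PosSemidef) (hr : ρ.rank = 1) :
    ∃ v : m → ℂ, ∀ x y, ρ x y = v x * star (v y) := by
  rw [h.1.rank_eq_card_non_zero_eigs, Fintype.card_eq_one_iff] at hr
  obtain ⟨⟨i, hi⟩, hu⟩ := hr
  have h0 : ∀ j, j ≠ i → h.1.eigenvalues j = 0 := by
    intro j hj
    by_contra hc
    exact hj (congrArg Subtype.val (hu ⟨j, hc⟩))
  refine ⟨fun x => (Real.sqrt (h.1.eigenvalues i) : ℂ) * (h.1.eigenvectorUnitary : Matrix m m ℂ) x i, ?_⟩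
  intro x y
  conv_lhs => rw [h.1.spectral_theorem]
  rw [Unitary.conjStarAlgAut_apply, Matrix.mul_apply, Finset.sum_eq_single i]
  · rw [Matrix.mul_diagonal]
    have hs : ((h.1.eigenvalues i : ℝ) : ℂ) =
        (Real.sqrt (h.1.eigenvalues i) : ℂ) * (Real.sqrt (h.1.eigenvalues i) : ℂ) := by
      rw [← Complex.ofReal_mul, Real.mul_self_sqrt (h.eigenvalues_nonneg i)]
    simp only [Function.comp_apply, star_apply, star_mul', Complex.star_def, Complex.conj_ofReal,
      Complex.coe_algebraMap]
    change _ * ((h.1.eigenvalues i : ℝ) : ℂ) * _ = _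
    rw [hs]
    ring
  · intro j _ hj
    rw [Matrix.mul_diagonal]
    simp [h0 j hj]
  · simp

open Matrix Kronecker in
theorem vnEntropy_kron {α β : Type*} [Fintype α] [DecidableEq α] [Fintype β] [DecidableEq β]
    (c : ℝ) (hc0 : ((c : ℂ) • (1 : Matrix α α ℂ)).trace = 1) (ρ : Matrix β β ℂ) (h : ρ.PosSemidef)
    (ht : ρ.trace = 1) :
    vnEntropy (((c : ℂ) • (1 : Matrix α α ℂ)) ⊗ₖ ρ) =
      - Real.log c + vnEntropy ρ := by
  have hc : (Fintype.card α : ℝ) * c = 1 := by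
    rw [Matrix.trace_smul, Matrix.trace_one, smul_eq_mul, mul_comm] at hc0
    exact_mod_cast hc0
  obtain ⟨U, l, hU, hU', hρ, hl, he⟩ := exists_diag ρ h
  have ht' := trace_of_diag ρ U l hU hρ ht
  have key := vnEntropy_of_diag (((c : ℂ) • (1 : Matrix α α ℂ)) ⊗ₖ ρ) ((1 : Matrix α α ℂ) ⊗ₖ U)
    (fun x => c * l x.2)
    (by rw [conjTranspose_kronecker, ← mul_kronecker_mul, hU]; simp)
    (by
      have : diagonal (fun x : α × β => ((c * l x.2 : ℝ) : ℂ)) =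
          ((c : ℂ) • (1 : Matrix α α ℂ)) ⊗ₖ diagonal (fun i => (l i : ℂ)) := by
        rw [← diagonal_one, ← diagonal_smul, diagonal_kronecker_diagonal]
        congr 1
        ext x
        simp
      rw [this, conjTranspose_kronecker, ← mul_kronecker_mul, ← mul_kronecker_mul, ← hρ]
      simp)
  rw [key, he, Fintype.sum_prod_type]
  simp only [Real.negMulLog_mul, Finset.sum_add_distrib, ← Finset.mul_sum, ← Finset.sum_mul, ht',
    Finset.sum_const, Finset.card_univ, nsmul_eq_mul]
  rw [one_mul, Real.negMulLog]
  linear_combination (- Real.log c + ∑ i, Real.negMulLog (l i)) * hc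

theorem vnEntropy_smul_one {α : Type*} [Fintype α] [DecidableEq α] 
    (c : ℝ) (hc0 : ((c : ℂ) • (1 : Matrix α α ℂ)).trace = 1) :
    vnEntropy ((c : ℂ) • (1 : Matrix α α ℂ)) = - Real.log c := by
  have hc : (Fintype.card α : ℝ) * c = 1 := by
    rw [Matrix.trace_smul, Matrix.trace_one, smul_eq_mul, mul_comm] at hc0
    exact_mod_cast hc0
  rw [vnEntropy_of_diag _ 1 (fun _ => c) (by simp) (by
    simp [Matrix.smul_one_eq_diagonal])]
  simp only [Real.negMulLog, Finset.sum_const, Finset.card_univ, nsmul_eq_mul]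
  linear_combination (- Real.log c) * hc

section marg
variable {ι : Type*} [Fintype ι] [DecidableEq ι] {dim : ι → ℕ}
    (ρ : Matrix ((i : ι) → Fin (dim i)) ((i : ι) → Fin (dim i)) ℂ)

theorem marginal_psd (h : ρ.PosSemidef) (S : Finset ι) : (marginal ρ S).PosSemidef := by
  have : marginal ρ S = ∑ z : (i : {j : ι // j ∉ S}) → Fin (dim i.1),
      ρ.submatrix (fun x i => if h : i ∈ S then x ⟨i, h⟩ else z ⟨i, h⟩)
        (fun x i => if h : i ∈ S then x ⟨i, h⟩ else z ⟨i, h⟩) := by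
    ext x y
    rw [Matrix.sum_apply]
    rfl
  rw [this]
  exact Matrix.posSemidef_sum _ fun z _ => h.submatrix _

theorem marginal_trace (S : Finset ι) : (marginal ρ S).trace = ρ.trace := by
  simp only [Matrix.trace, Matrix.diag, marginal]
  refine (Fintype.sum_prod_type' (fun (x : (i : {j : ι // j ∈ S}) → Fin (dim i.1))
    (z : (i : {j : ι // j ∉ S}) → Fin (dim i.1)) =>
      ρ (fun i => if h : i ∈ S then x ⟨i, h⟩ else z ⟨i, h⟩)
      (fun i => if h : i ∈ S then x ⟨i, h⟩ else z ⟨i, h⟩))).symm.trans ?_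
  exact (Equiv.piEquivPiSubtypeProd (fun i => i ∈ S) (fun i => Fin (dim i))).symm.sum_comp
    (fun x => ρ x x)

/-- splitting a disjoint union -/
def splitEquiv (dim : ι → ℕ) (S T U : Finset ι) (hST : Disjoint S T)
    (hU : ∀ j, j ∈ U ↔ j ∈ S ∨ j ∈ T) :
    (((i : {j : ι // j ∈ S}) → Fin (dim i.1)) × ((i : {j : ι // j ∈ T}) → Fin (dim i.1))) ≃
      ((i : {j : ι // j ∈ U}) → Fin (dim i.1)) where
  toFun p := fun i => if h : i.1 ∈ S then p.1 ⟨i.1, h⟩ else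
    p.2 ⟨i.1, ((hU _).1 i.2).resolve_left h⟩
  invFun x := (fun i => x ⟨i.1, (hU _).2 (Or.inl i.2)⟩,
    fun i => x ⟨i.1, (hU _).2 (Or.inr i.2)⟩)
  left_inv p := by
    ext i
    · simp
    · have : i.1 ∉ S := fun h => (Finset.disjoint_left.1 hST h) i.2
      simp [this]
  right_inv x := by
    ext i
    simp

/-- splitting the complement -/
def complEquiv (dim : ι → ℕ) (S T U : Finset ι) (hST : Disjoint S T)
    (hU : ∀ j, j ∈ U ↔ j ∈ S ∨ j ∈ T) :
    (((i : {j : ι // j ∈ T}) → Fin (dim i.1)) × ((i : {j : ι // j ∉ U}) → Fin (dim i.1))) ≃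
      ((i : {j : ι // j ∉ S}) → Fin (dim i.1)) where
  toFun p := fun i => if h : i.1 ∈ T then p.1 ⟨i.1, h⟩ else
    p.2 ⟨i.1, fun hh => ((hU _).1 hh).elim i.2 h⟩
  invFun x := (fun i => x ⟨i.1, fun h => Finset.disjoint_left.1 hST h i.2⟩,
    fun i => x ⟨i.1, fun h => i.2 ((hU _).2 (Or.inl h))⟩)
  left_inv p := by
    ext i
    · simp
    · have : i.1 ∉ T := fun h => i.2 ((hU _).2 (Or.inr h))
      simp [this]
  right_inv x := by
    funext i
    by_cases h : i.1 ∈ T <;> simp [h]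

theorem marginal_left (S T U : Finset ι) (hST : Disjoint S T)
    (hU : ∀ j, j ∈ U ↔ j ∈ S ∨ j ∈ T) (x y) :
    marginal ρ S x y = ∑ z, marginal ρ U (splitEquiv dim S T U hST hU (x, z))
      (splitEquiv dim S T U hST hU (y, z)) := by
  unfold marginal
  rw [← (complEquiv dim S T U hST hU).sum_comp, Fintype.sum_prod_type]
  refine Finset.sum_congr rfl fun z _ => Finset.sum_congr rfl fun w _ => ?_
  congr 1 <;>
  · funext i
    by_cases h1 : i ∈ S <;> by_cases h2 : i ∈ T <;> simp [h1, h2, hU, splitEquiv, complEquiv]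

theorem marginal_right (S T U : Finset ι) (hST : Disjoint S T)
    (hU : ∀ j, j ∈ U ↔ j ∈ S ∨ j ∈ T) (x y) :
    marginal ρ T x y = ∑ z, marginal ρ U (splitEquiv dim S T U hST hU (z, x))
      (splitEquiv dim S T U hST hU (z, y)) := by
  unfold marginal
  rw [← (complEquiv dim T S U hST.symm (fun j => (hU j).trans or_comm)).sum_comp,
    Fintype.sum_prod_type]
  refine Finset.sum_congr rfl fun z _ => Finset.sum_congr rfl fun w _ => ?_
  congr 1 <;>
  · funext i
    have h3 : i ∈ S → i ∉ T := fun h => Finset.disjoint_left.1 hST h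
    by_cases h1 : i ∈ S <;> by_cases h2 : i ∈ T
    · exact absurd h2 (h3 h1)
    all_goals simp [h1, h2, hU, splitEquiv, complEquiv]

theorem mEnt_subadd (h : ρ.PosSemidef) (ht : ρ.trace = 1) (S T U : Finset ι) (hST : Disjoint S T)
    (hU : ∀ j, j ∈ U ↔ j ∈ S ∨ j ∈ T) : mEnt ρ U ≤ mEnt ρ S + mEnt ρ T := by
  unfold mEnt
  rw [← vnEntropy_reindex (splitEquiv dim S T U hST hU) _ (marginal_psd ρ h U).1]
  exact vnEntropy_subadd _ ((marginal_psd ρ h U).submatrix _) _ _ (marginal_psd ρ h S)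
    (marginal_psd ρ h T) ((marginal_trace ρ S).trans ht)
    (marginal_left ρ S T U hST hU) (marginal_right ρ S T U hST hU)

open Matrix in
theorem mEnt_pure (h : ρ.PosSemidef) (hr : ρ.rank = 1) (S T : Finset ι) (hST : Disjoint S T)
    (hU : ∀ j, j ∈ S ∨ j ∈ T) : mEnt ρ S = mEnt ρ T := by
  obtain ⟨v, hv⟩ := pure_vec ρ h hr
  have hU' : ∀ j, j ∈ (Finset.univ : Finset ι) ↔ j ∈ S ∨ j ∈ T := fun j => by simp [hU j]
  have huniv : ∀ x y, marginal ρ Finset.univ x y =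
      v (fun i => x ⟨i, Finset.mem_univ i⟩) * star (v (fun i => y ⟨i, Finset.mem_univ i⟩)) := by
    intro x y
    have : IsEmpty {j : ι // j ∉ (Finset.univ : Finset ι)} := ⟨fun j => j.2 (Finset.mem_univ _)⟩
    simp [marginal, hv]
  let M : Matrix ((i : {j : ι // j ∈ S}) → Fin (dim i.1)) ((i : {j : ι // j ∈ T}) → Fin (dim i.1)) ℂ :=
    Matrix.of fun x z =>
      v (fun i => splitEquiv dim S T Finset.univ hST hU' (x, z) ⟨i, Finset.mem_univ i⟩)
  have e1 : marginal ρ S = M * Mᴴ := by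
    ext x y
    rw [marginal_left ρ S T Finset.univ hST hU', Matrix.mul_apply]
    refine Finset.sum_congr rfl fun z _ => ?_
    rw [huniv]; rfl
  have e2 : marginal ρ T = (Mᴴ * M)ᵀ := by
    ext x y
    rw [marginal_right ρ S T Finset.univ hST hU', Matrix.transpose_apply, Matrix.mul_apply]
    refine Finset.sum_congr rfl fun z _ => ?_
    rw [huniv, mul_comm]; rfl
  unfold mEnt
  rw [e1, e2]
  exact vnEntropy_mul_comm M

theorem mEnt_maxmix (ht : ρ.trace = 1) (S : Finset ι) (c : ℝ) (h : marginal ρ S = (c : ℂ) • 1) :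
    mEnt ρ S = - Real.log c := by
  unfold mEnt
  have := marginal_trace ρ S
  rw [h, ht] at this
  rw [h]
  exact vnEntropy_smul_one c this

theorem mEnt_prod (hpsd : ρ.PosSemidef) (ht : ρ.trace = 1) (S T U : Finset ι) (hST : Disjoint S T)
    (hU : ∀ j, j ∈ U ↔ j ∈ S ∨ j ∈ T) (hS : S ⊆ U) (hT : T ⊆ U)
    (c : ℝ) (h : marginal ρ S = (c : ℂ) • 1)
    (hprod : ∀ x y, marginal ρ U x y = marginal ρ S (restInd hS x) (restInd hS y) *
      marginal ρ T (restInd hT x) (restInd hT y)) :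
    mEnt ρ U = - Real.log c + mEnt ρ T := by
  unfold mEnt
  have htr := marginal_trace ρ S
  rw [h, ht] at htr
  rw [← vnEntropy_reindex (splitEquiv dim S T U hST hU) _ (marginal_psd ρ hpsd _).1]
  have := vnEntropy_kron c htr _ (marginal_psd ρ hpsd T) ((marginal_trace ρ _).trans ht)
  rw [← this, ← h]
  congr 1
  ext ⟨x, z⟩ ⟨y, w⟩
  rw [Matrix.submatrix_apply, hprod, Matrix.kroneckerMap_apply]
  have hl : ∀ p, restInd hS (splitEquiv dim S T U hST hU p) = p.1 := fun p =>
    congrArg Prod.fst ((splitEquiv dim S T U hST hU).left_inv p)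
  have hr : ∀ p, restInd hT (splitEquiv dim S T U hST hU p) = p.2 := fun p =>
    congrArg Prod.snd ((splitEquiv dim S T U hST hU).left_inv p)
  rw [hl, hl, hr, hr]

end marg

/-- mutual-information bound for entanglement-assisted codes:
for a fixed admissible partition, `2 log K ≤ S(X_[n]) + S(X_I) - S(X_J) ≤ 2 S(X_I)`.
Systems: `R = Sum.inr 0`, `A_f = Sum.inr 1`, `B_in = Sum.inr 2`. -/
theorem ea_mutual_information_bound
    (n d q K : ℕ) (hd : 2 ≤ d) (hdn : d ≤ n) (hq : 2 ≤ q) (hK : 1 ≤ K)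
    (dim : Fin n ⊕ Fin 3 → ℕ)
    (hdimX : ∀ i : Fin n, dim (Sum.inl i) = q)
    (hdimR : dim (Sum.inr 0) = K)
    (ψ : Matrix ((i : Fin n ⊕ Fin 3) → Fin (dim i))
                ((i : Fin n ⊕ Fin 3) → Fin (dim i)) ℂ)
    (hpsd : ψ.PosSemidef) (htr : ψ.trace = 1) (hpure : ψ.rank = 1)
    (hmaxmix : marginal ψ ({Sum.inr 0} : Finset (Fin n ⊕ Fin 3)) = (K : ℂ)⁻¹ • 1)
    (hprod : ∀ x y, marginal ψ ({Sum.inr 0, Sum.inr 2} : Finset (Fin n ⊕ Fin 3)) x y =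
      marginal ψ ({Sum.inr 0} : Finset (Fin n ⊕ Fin 3))
          (restInd (by simp) x) (restInd (by simp) y) *
        marginal ψ ({Sum.inr 2} : Finset (Fin n ⊕ Fin 3))
          (restInd (by simp) x) (restInd (by simp) y))
    (I J : Finset (Fin n)) (hIJdisj : Disjoint I J) (hIJ : I ∪ J = Finset.univ)
    (hIcard : I.card = n - d + 1) (hJcard : J.card = d - 1)
    (hdec : mEnt ψ (I.image Sum.inl ∪ ({Sum.inr 2} : Finset (Fin n ⊕ Fin 3))) =
      mEnt ψ ({Sum.inr 0} : Finset (Fin n ⊕ Fin 3)) + mEnt ψ ({Sum.inr 1} : Finset (Fin n ⊕ Fin 3)) + mEnt ψ (J.image Sum.inl)) :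
    2 * Real.log K
      ≤ mEnt ψ ((Finset.univ : Finset (Fin n)).image Sum.inl)
          + mEnt ψ (I.image Sum.inl) - mEnt ψ (J.image Sum.inl)
    ∧ mEnt ψ ((Finset.univ : Finset (Fin n)).image Sum.inl)
          + mEnt ψ (I.image Sum.inl) - mEnt ψ (J.image Sum.inl)
      ≤ 2 * mEnt ψ (I.image Sum.inl) := by
  have hmax' : marginal ψ ({Sum.inr 0} : Finset (Fin n ⊕ Fin 3)) = (((K : ℝ)⁻¹ : ℝ) : ℂ) • 1 := by
    rw [hmaxmix]; push_cast; rfl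
  have hR : mEnt ψ ({Sum.inr 0} : Finset (Fin n ⊕ Fin 3)) = Real.log K := by
    rw [mEnt_maxmix ψ htr _ _ hmax', Real.log_inv, neg_neg]
  have hdRB : Disjoint ({Sum.inr 0} : Finset (Fin n ⊕ Fin 3)) {Sum.inr 2} := by simp
  have hURB : ∀ j, j ∈ ({Sum.inr 0, Sum.inr 2} : Finset (Fin n ⊕ Fin 3)) ↔
      j ∈ ({Sum.inr 0} : Finset (Fin n ⊕ Fin 3)) ∨ j ∈ ({Sum.inr 2} : Finset (Fin n ⊕ Fin 3)) := by
    simp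
  have hRB : mEnt ψ ({Sum.inr 0, Sum.inr 2} : Finset (Fin n ⊕ Fin 3)) =
      Real.log K + mEnt ψ ({Sum.inr 2} : Finset (Fin n ⊕ Fin 3)) := by
    rw [mEnt_prod ψ hpsd htr _ _ _ hdRB hURB (by simp) (by simp) _ hmax' hprod,
      Real.log_inv, neg_neg]
  have hpur := mEnt_pure ψ hpsd hpure ({Sum.inr 0, Sum.inr 2} : Finset (Fin n ⊕ Fin 3))
    ((Finset.univ : Finset (Fin n)).image Sum.inl ∪ {Sum.inr 1})
    (by simp [Finset.disjoint_left])
    (by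
      rintro (j | j)
      · simp
      · fin_cases j <;> simp)
  have s1 := mEnt_subadd ψ hpsd htr ((Finset.univ : Finset (Fin n)).image Sum.inl) {Sum.inr 1}
    ((Finset.univ : Finset (Fin n)).image Sum.inl ∪ {Sum.inr 1})
    (by simp) (by simp)
  have s2 := mEnt_subadd ψ hpsd htr (I.image Sum.inl) {Sum.inr 2}
    (I.image Sum.inl ∪ ({Sum.inr 2} : Finset (Fin n ⊕ Fin 3)))
    (by simp) (fun j => Finset.mem_union)
  have s3 := mEnt_subadd ψ hpsd htr (I.image Sum.inl) (J.image Sum.inl)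
    ((Finset.univ : Finset (Fin n)).image Sum.inl)
    (by rw [Finset.disjoint_image Sum.inl_injective]; exact hIJdisj)
    (fun j => by rw [← hIJ, Finset.image_union, Finset.mem_union])
  rw [hR] at hdec
  constructor <;> linarith
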